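/- Let μ = ∑_{k=1}^m π_k (μ_{k1} × ⋯ × μ_{kd}) be a mixture of product measures. If there exists a partition of {1,…,d} into three pairwise disjoint subsets S₁, S₂, S₃ with S₁ ∪ S₂ ∪ S₃ = {1,…,d} such that τ_μ(S₁) + τ_μ(S₂) + τ_μ(S₃) ≥ 2m + 2, then μ is identifiable. -/

import Mathlib

open MeasureTheory

/-- The mixture of product measures `∑ k, π k • (μ k 1 × ⋯ × μ k d)` on `ℝ^d`. -/
noncomputable def mixtureOfProducts {m d : ℕ}
    (π : Fin m → ℝ) (μ : Fin m → Fin d → ProbabilityMeasure ℝ) :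
    Measure (Fin d → ℝ) :=
  ∑ k, ENNReal.ofReal (π k) • Measure.pi (fun j => (μ k j : Measure ℝ))

/-- Identifiability of the mixture representation `(π, μ)`. -/
def IsIdentifiable {m d : ℕ}
    (π : Fin m → ℝ) (μ : Fin m → Fin d → ProbabilityMeasure ℝ) : Prop :=
  ∀ (π' : Fin m → ℝ) (μ' : Fin m → Fin d → ProbabilityMeasure ℝ),
    (∀ k, 0 < π' k) → (∑ k, π' k = 1) →
    mixtureOfProducts π' μ' = mixtureOfProducts π μ →
    ∃ σ : Equiv.Perm (Fin m), ∀ k : Fin m,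
      π k = π' (σ k) ∧ ∀ j : Fin d, μ k j = μ' (σ k) j

/-- A family `ν` of probability measures is `ℓ`-independent if every subfamily of
cardinality `ℓ` is linearly independent in the space of finite signed measures. -/
def EllIndep {m : ℕ} (ν : Fin m → ProbabilityMeasure ℝ) (ℓ : ℕ) : Prop :=
  ∀ I : Finset (Fin m), I.card = ℓ →
    LinearIndependent ℝ (fun i : I => ((ν i : Measure ℝ)).toSignedMeasure)

/-- `Ind(ν)`: the largest `ℓ ≤ m` such that `ν` is `ℓ`-independent. -/
noncomputable def indOf {m : ℕ} (ν : Fin m → ProbabilityMeasure ℝ) : ℕ :=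
  sSup {ℓ : ℕ | ℓ ≤ m ∧ EllIndep ν ℓ}

/-- `τ_μ(S) = min {m, Ind_μ(S) − |S| + 1}` (with truncated subtraction). -/
noncomputable def tauOf {m d : ℕ} (μ : Fin m → Fin d → ProbabilityMeasure ℝ)
    (S : Finset (Fin d)) : ℕ :=
  min m ((∑ j ∈ S, indOf (fun k => μ k j)) - S.card + 1)

section Splitting

open Module Submodule

variable {K ι U W X : Type*} [Field K] [AddCommGroup U] [Module K U]
  [AddCommGroup W] [Module K W]

/-- The dimension of the span of the subfamily of `w` indexed by the finset `F`. -/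
noncomputable def rankOn (K : Type*) {ι W : Type*} [Field K] [AddCommGroup W] [Module K W]
    (w : ι → W) (F : Finset ι) : ℕ :=
  finrank K (span K (w '' F))

/-- A finite family is connected if it has no partition into two nonempty subfamilies whose spans
intersect trivially. -/
def ConnectedOn (K : Type*) {ι W : Type*} [Field K] [DecidableEq ι] [AddCommGroup W] [Module K W]
    (w : ι → W) (E : Finset ι) : Prop :=
  ∀ S ⊆ E, S.Nonempty → (E \ S).Nonempty →
    ¬ Disjoint (span K (w '' S)) (span K (w '' (E \ S : Finset ι)))

instance finiteDimensional_span_image_finset (w : ι → W) (F : Finset ι) :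
    FiniteDimensional K (span K (w '' F)) :=
  FiniteDimensional.span_of_finite K (F.finite_toSet.image w)

theorem rankOn_mono (w : ι → W) {F G : Finset ι} (h : F ⊆ G) : rankOn K w F ≤ rankOn K w G :=
  Submodule.finrank_mono (span_mono (Set.image_mono (Finset.coe_subset.2 h)))

theorem rankOn_le_card (w : ι → W) (F : Finset ι) : rankOn K w F ≤ F.card := by
  classical
  have h := finrank_span_finset_le_card (R := K) (F.image w)
  rw [Finset.coe_image] at h
  exact h.trans Finset.card_image_le

theorem rankOn_eq_card {w : ι → W} {F : Finset ι} (h : LinearIndepOn K w (F : Set ι)) :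
    rankOn K w F = F.card := by
  have := finrank_span_eq_card h
  rw [rankOn, Set.image_eq_range]
  simpa using this

theorem rankOn_singleton {w : ι → W} {a : ι} (h : w a ≠ 0) : rankOn K w {a} = 1 := by
  rw [rankOn, Finset.coe_singleton, Set.image_singleton, finrank_span_singleton h]

/-- Think of `w e` as the tensor product of `u e` with the function `v e` on `X`, and of `T y` as
contraction against evaluation at `y`. If the spans of two subfamilies of `u` intersect trivially,
then so do the spans of the corresponding subfamilies of `w`. -/
theorem disjoint_span_of_slices {u : ι → U} {v : ι → X → K} {w : ι → W} (T : X → W →ₗ[K] U)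
    (hT : ∀ y e, T y (w e) = v e y • u e) (hinj : ∀ t, (∀ y, T y t = 0) → t = 0)
    {F G : Finset ι} (h : Disjoint (span K (u '' F)) (span K (u '' G))) :
    Disjoint (span K (w '' F)) (span K (w '' G)) := by
  have key : ∀ (H : Finset ι) (y : X) (t : W), t ∈ span K (w '' H) →
      T y t ∈ span K (u '' H) := by
    intro H y t ht
    induction ht using Submodule.span_induction with
    | mem x hx =>
      obtain ⟨e, he, rfl⟩ := hx
      rw [hT]
      exact smul_mem _ _ (subset_span ⟨e, he, rfl⟩)
    | zero => simp
    | add x z _ _ hx hz => rw [map_add]; exact add_mem hx hz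
    | smul a x _ hx => rw [map_smul]; exact smul_mem _ _ hx
  rw [Submodule.disjoint_def] at h ⊢
  exact fun t h1 h2 => hinj t fun y => h _ (key F y t h1) (key G y t h2)

variable [DecidableEq ι]

theorem span_image_union (w : ι → W) (F G : Finset ι) :
    span K (w '' (F ∪ G : Finset ι)) = span K (w '' F) ⊔ span K (w '' G) := by
  rw [Finset.coe_union, Set.image_union, span_union]

theorem rankOn_union_le (w : ι → W) (F G : Finset ι) :
    rankOn K w (F ∪ G) ≤ rankOn K w F + rankOn K w G := by
  rw [rankOn, span_image_union]
  exact Submodule.finrank_add_le_finrank_add_finrank _ _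

theorem rankOn_union_of_disjoint {w : ι → W} {F G : Finset ι}
    (h : Disjoint (span K (w '' F)) (span K (w '' G))) :
    rankOn K w (F ∪ G) = rankOn K w F + rankOn K w G := by
  have := Submodule.finrank_sup_add_finrank_inf_eq (span K (w '' F)) (span K (w '' G))
  rw [h.eq_bot, finrank_bot, add_zero] at this
  rw [rankOn, span_image_union, this, rankOn, rankOn]

theorem rankOn_union_lt_of_not_disjoint {w : ι → W} {F G : Finset ι}
    (h : ¬ Disjoint (span K (w '' F)) (span K (w '' G))) :
    rankOn K w (F ∪ G) + 1 ≤ rankOn K w F + rankOn K w G := by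
  have := Submodule.finrank_sup_add_finrank_inf_eq (span K (w '' F)) (span K (w '' G))
  have h1 : 1 ≤ finrank K (span K (w '' F) ⊓ span K (w '' G) : Submodule K W) := by
    rw [Submodule.one_le_finrank_iff]
    exact fun h' => h (disjoint_iff.2 h')
  rw [rankOn, span_image_union, rankOn, rankOn]
  omega

theorem span_erase_eq_of_mem {w : ι → W} {F : Finset ι} {a : ι}
    (h : w a ∈ span K (w '' (F.erase a : Finset ι))) :
    span K (w '' (F.erase a : Finset ι)) = span K (w '' F) := by
  refine le_antisymm (span_mono (Set.image_mono (Finset.coe_subset.2 (F.erase_subset a)))) ?_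
  rw [span_le]
  rintro _ ⟨b, hb, rfl⟩
  by_cases hba : b = a
  · exact hba ▸ h
  · exact subset_span ⟨b, by simpa [hba] using hb, rfl⟩

theorem mem_span_erase_of_sum_eq_zero {w : ι → W} {F : Finset ι} {a : ι} (ha : a ∈ F)
    {c : ι → K} (hc : c a ≠ 0) (h : ∑ e ∈ F, c e • w e = 0) :
    w a ∈ span K (w '' (F.erase a : Finset ι)) := by
  rw [← Finset.add_sum_erase _ _ ha] at h
  rw [← Submodule.smul_mem_iff _ hc, eq_neg_of_add_eq_zero_left h]
  exact neg_mem (sum_mem fun e he => smul_mem _ _ (subset_span ⟨e, he, rfl⟩))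

theorem rankOn_lt_card_of_sum_eq_zero {w : ι → W} {F : Finset ι} {a : ι} (ha : a ∈ F)
    {c : ι → K} (hc : c a ≠ 0) (h : ∑ e ∈ F, c e • w e = 0) : rankOn K w F < F.card := by
  rw [rankOn, ← span_erase_eq_of_mem (mem_span_erase_of_sum_eq_zero ha hc h)]
  exact (rankOn_le_card w _).trans_lt (Finset.card_erase_lt_of_mem ha)

theorem ConnectedOn.of_slices {u : ι → U} {v : ι → X → K} {w : ι → W} (T : X → W →ₗ[K] U)
    (hT : ∀ y e, T y (w e) = v e y • u e) (hinj : ∀ t, (∀ y, T y t = 0) → t = 0)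
    {E : Finset ι} (h : ConnectedOn K w E) : ConnectedOn K u E :=
  fun S hS h1 h2 hd => h S hS h1 h2 (disjoint_span_of_slices T hT hinj hd)

/-- If a combination of the `u b ⊗ v b`, `b ∈ G`, with nonzero coefficients lies in the span of the
`u a ⊗ v a`, `a ∈ F`, then the rank of `v` grows from `F` to `F ∪ G` by at most
`|G| - rank (u on G)`. -/
theorem rankOn_union_add_rankOn_le {u : ι → U} {v : ι → X → K} {w : ι → W} (T : X → W →ₗ[K] U)
    (hT : ∀ y e, T y (w e) = v e y • u e) {F G : Finset ι} {c : ι → K}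
    (hc : ∀ b ∈ G, c b ≠ 0) (hmem : ∑ b ∈ G, c b • w b ∈ span K (w '' F)) :
    rankOn K v (F ∪ G) + rankOn K u G ≤ rankOn K v F + G.card := by
  obtain ⟨B', hBG, -, hspan, hind⟩ := exists_linearIndepOn_extension
    (linearIndepOn_empty K u) (Set.empty_subset (G : Set ι))
  obtain ⟨B, rfl⟩ : ∃ B : Finset ι, (B : Set ι) = B' :=
    ⟨(G.finite_toSet.subset hBG).toFinset, by simp⟩
  have hBG' : B ⊆ G := Finset.coe_subset.1 hBG
  have hrank : rankOn K u G ≤ B.card := by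
    rw [← rankOn_eq_card hind]
    exact Submodule.finrank_mono (span_le.2 hspan)
  have hv : ∀ b ∈ B, v b ∈ span K (v '' (F ∪ (G \ B) : Finset ι)) := by
    intro b hb
    obtain ⟨ψ, hψ, hker⟩ := Submodule.exists_le_ker_of_notMem (hind.notMem_span hb)
    let L : W →ₗ[K] (X → K) := LinearMap.pi fun y => ψ ∘ₗ T y
    have hL : ∀ e, L (w e) = ψ (u e) • v e := by
      intro e
      ext y
      simp [L, hT, mul_comm]
    have hLmem : L (∑ b ∈ G, c b • w b) ∈ span K (v '' F) := by
      have : L (∑ b ∈ G, c b • w b) ∈ (span K (w '' F)).map L := mem_map_of_mem hmem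
      refine (map_span_le L _ _).2 ?_ this
      rintro _ ⟨a, ha, rfl⟩
      rw [hL]
      exact smul_mem _ _ (subset_span ⟨a, ha, rfl⟩)
    rw [map_sum] at hLmem
    have hzero : ∀ e ∈ B, e ≠ b → ψ (u e) = 0 := fun e he heb =>
      hker (subset_span ⟨e, ⟨he, heb⟩, rfl⟩)
    rw [← Finset.sum_sdiff hBG', Finset.sum_eq_single_of_mem b hb
      (fun e he heb => by rw [map_smul, hL, hzero e he heb, zero_smul, smul_zero])] at hLmem
    rw [span_image_union, ← Submodule.smul_mem_iff _ (mul_ne_zero (hc b (hBG' hb)) hψ)]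
    have h2 : ∑ e ∈ G \ B, L (c e • w e) ∈ span K (v '' (G \ B : Finset ι)) := by
      refine sum_mem fun e he => ?_
      rw [map_smul, hL]
      exact smul_mem _ _ (smul_mem _ _ (subset_span ⟨e, he, rfl⟩))
    have := sub_mem (mem_sup_left (T := span K (v '' (G \ B : Finset ι))) hLmem)
      (mem_sup_right (S := span K (v '' F)) h2)
    rwa [add_sub_cancel_left, map_smul, hL, smul_smul] at this
  have hle : rankOn K v (F ∪ G) ≤ rankOn K v (F ∪ (G \ B)) := by
    refine Submodule.finrank_mono (span_le.2 ?_)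
    rintro _ ⟨e, he, rfl⟩
    by_cases heB : e ∈ B
    · exact hv e heB
    · refine subset_span ⟨e, ?_, rfl⟩
      simp only [Finset.coe_union, Set.mem_union, Finset.mem_coe, Finset.mem_sdiff] at he ⊢
      tauto
  have h1 := rankOn_union_le (K := K) v F (G \ B)
  have h2 := rankOn_le_card (K := K) v (G \ B)
  have h3 := Finset.card_sdiff_add_card_eq_card hBG'
  omega

theorem rankOn_union_of_minimal {w : ι → W} {F G : Finset ι} (hG : G.Nonempty)
    (hnd : ¬ Disjoint (span K (w '' F)) (span K (w '' G)))
    (hmin : ∀ b ∈ G, Disjoint (span K (w '' F)) (span K (w '' (G.erase b : Finset ι)))) :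
    rankOn K w F + G.card ≤ rankOn K w (F ∪ G) + 1 := by
  obtain ⟨b, hb⟩ := hG
  have hind : LinearIndepOn K w (G : Set ι) := by
    rw [linearIndepOn_iff_notMem_span]
    intro a ha hmem
    rw [← Finset.coe_erase] at hmem
    exact hnd (span_erase_eq_of_mem hmem ▸ hmin a ha)
  have h1 := rankOn_union_of_disjoint (hmin b hb)
  have h2 := rankOn_eq_card (hind.mono (Finset.coe_subset.2 (G.erase_subset b)))
  have h3 := rankOn_mono (K := K) w (Finset.union_subset_union_right (s := F) (G.erase_subset b))
  have h4 := Finset.card_erase_add_one hb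
  omega

theorem ConnectedOn.rankOn_add_rankOn_le {u : ι → U} {v : ι → X → K} {w : ι → W}
    (T : X → W →ₗ[K] U) (hT : ∀ y e, T y (w e) = v e y • u e)
    (hinj : ∀ t, (∀ y, T y t = 0) → t = 0) (hw : ∀ e, w e ≠ 0)
    {E : Finset ι} (hE : E.Nonempty) (h : ConnectedOn K w E) :
    rankOn K u E + rankOn K v E ≤ rankOn K w E + 1 := by
  classical
  obtain ⟨a, ha⟩ := hE
  let P : Finset (Finset ι) := {F ∈ E.powerset | F.Nonempty ∧
    rankOn K u F + rankOn K v F ≤ rankOn K w F + 1}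
  have haP : {a} ∈ P := by
    have h1 := rankOn_le_card (K := K) u {a}
    have h2 := rankOn_le_card (K := K) v {a}
    have h3 : rankOn K w {a} = 1 := rankOn_singleton (hw a)
    simp only [Finset.card_singleton] at h1 h2
    simp only [P, Finset.mem_filter, Finset.mem_powerset, Finset.singleton_subset_iff]
    exact ⟨ha, Finset.singleton_nonempty a, by omega⟩
  obtain ⟨F, hFP, hFmax⟩ := P.exists_max_image Finset.card ⟨_, haP⟩
  obtain ⟨hFE, hFne, hF⟩ : F ⊆ E ∧ F.Nonempty ∧ rankOn K u F + rankOn K v F ≤ rankOn K w F + 1 := by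
    simpa [P] using hFP
  by_cases hEF : (E \ F).Nonempty
  · exfalso
    let R : Finset (Finset ι) := {G ∈ (E \ F).powerset |
      ¬ Disjoint (span K (w '' F)) (span K (w '' (G : Finset ι)))}
    have hR : R.Nonempty := ⟨E \ F, by simpa [R] using h F hFE hFne hEF⟩
    obtain ⟨G, hGR, hGmin⟩ := R.exists_min_image Finset.card hR
    obtain ⟨hGE, hnd⟩ : G ⊆ E \ F ∧ ¬ Disjoint (span K (w '' F)) (span K (w '' G)) := by
      simpa [R] using hGR
    have hmin : ∀ b ∈ G, Disjoint (span K (w '' F)) (span K (w '' (G.erase b : Finset ι))) := by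
      intro b hb
      by_contra hcon
      have hmem : G.erase b ∈ R :=
        Finset.mem_filter.2 ⟨Finset.mem_powerset.2 ((G.erase_subset b).trans hGE), hcon⟩
      exact absurd (hGmin _ hmem) (not_le.2 (Finset.card_erase_lt_of_mem hb))
    obtain ⟨t, htF, htG, ht⟩ : ∃ t ∈ span K (w '' F), t ∈ span K (w '' G) ∧ t ≠ 0 := by
      simpa [Submodule.disjoint_def] using hnd
    obtain ⟨c, rfl⟩ := (Submodule.mem_span_image_finset_iff_exists_fun' K).1 htG
    have hGne : G.Nonempty := by
      by_contra hG
      simp [Finset.not_nonempty_iff_eq_empty.1 hG] at ht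
    have hc : ∀ b ∈ G, c b ≠ 0 := by
      intro b hb hcb
      refine ht ((Submodule.disjoint_def.1 (hmin b hb)) _ htF ?_)
      rw [← Finset.add_sum_erase _ _ hb, hcb, zero_smul, zero_add]
      exact sum_mem fun e he => smul_mem _ _ (subset_span ⟨e, he, rfl⟩)
    have h1 := rankOn_union_of_minimal hGne hnd hmin
    have h2 := rankOn_union_add_rankOn_le T hT hc htF
    have h3 := rankOn_union_lt_of_not_disjoint
      (fun hd => hnd (disjoint_span_of_slices T hT hinj hd))
    have hmem : F ∪ G ∈ P := by
      refine Finset.mem_filter.2 ⟨Finset.mem_powerset.2 (Finset.union_subset hFE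
        (hGE.trans Finset.sdiff_subset)), hFne.mono Finset.subset_union_left, by omega⟩
    have h4 := hFmax _ hmem
    rw [Finset.card_union_of_disjoint
      (Finset.disjoint_of_subset_right hGE Finset.disjoint_sdiff)] at h4
    have := hGne.card_pos
    omega
  · rw [Finset.not_nonempty_iff_eq_empty, Finset.sdiff_eq_empty_iff_subset] at hEF
    rwa [hFE.antisymm hEF] at hF

/-- **Splitting theorem**: a connected family of product functions has large rank. -/
theorem ConnectedOn.sum_rankOn_le {κ : Type*} [DecidableEq κ] (x : ι → κ → X → K)
    {E : Finset ι} (hE : E.Nonempty) (J : Finset κ)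
    (hne : ∀ e j, x e j ≠ 0)
    (h : ConnectedOn K (fun e (A : κ → X) => ∏ j ∈ J, x e j (A j)) E) :
    1 + ∑ j ∈ J, rankOn K (fun e => x e j) E ≤
      rankOn K (fun e (A : κ → X) => ∏ j ∈ J, x e j (A j)) E + J.card := by
  have hprod : ∀ (J : Finset κ) e, (fun A : κ → X => ∏ j ∈ J, x e j (A j)) ≠ 0 := by
    intro J e h0
    choose A hA using fun j => Function.ne_iff.1 (hne e j)
    exact Finset.prod_ne_zero_iff.2 (fun j _ => hA j) (congrFun h0 A)
  induction J using Finset.induction_on with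
  | empty =>
    obtain ⟨a, ha⟩ := hE
    have h1 := rankOn_mono (K := K) (fun e (A : κ → X) => ∏ j ∈ (∅ : Finset κ), x e j (A j))
      (Finset.singleton_subset_iff.2 ha)
    have h2 : rankOn K (fun e (A : κ → X) => ∏ j ∈ (∅ : Finset κ), x e j (A j)) {a} = 1 :=
      rankOn_singleton (hprod ∅ a)
    simp only [Finset.sum_empty, Finset.card_empty]
    omega
  | insert j J hj ih =>
    let T : X → ((κ → X) → K) →ₗ[K] ((κ → X) → K) :=
      fun y => LinearMap.funLeft K K fun A => Function.update A j y
    have hT : ∀ y e, T y (fun A => ∏ i ∈ insert j J, x e i (A i)) =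
        x e j y • fun A => ∏ i ∈ J, x e i (A i) := by
      intro y e
      ext A
      simp only [T, LinearMap.funLeft_apply, Pi.smul_apply, smul_eq_mul, Finset.prod_insert hj,
        Function.update_self]
      congr 1
      refine Finset.prod_congr rfl fun i hi => ?_
      rw [Function.update_of_ne (ne_of_mem_of_not_mem hi hj)]
    have hinj : ∀ t, (∀ y, T y t = 0) → t = 0 := by
      intro t ht
      ext A
      simpa [T, LinearMap.funLeft_apply] using congrFun (ht (A j)) A
    have h1 := ih (h.of_slices T hT hinj)
    have h2 := h.rankOn_add_rankOn_le T hT hinj (hprod _) hE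
    rw [Finset.sum_insert hj, Finset.card_insert_of_notMem hj]
    omega

end Splitting

section Matching

open Module Submodule

variable {K α β κ X : Type*} [Field K] [DecidableEq α] [DecidableEq β] [Fintype κ] [DecidableEq κ]

/-- Under the rank hypothesis `hrank`, a linear relation with nonzero coefficients between
product functions, involving at least as many left as right indices, contains a relation between
one left and one right index. -/
theorem exists_pair_relation {x : α ⊕ β → κ → X → K} {c : α ⊕ β → K} (hc : ∀ e, c e ≠ 0)
    (hne : ∀ e j, x e j ≠ 0) {n : ℕ}
    (hrank : ∀ E : Finset (α ⊕ β), 2 ≤ E.toLeft.card → E.toLeft.card ≤ n →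
      2 * E.toLeft.card + Fintype.card κ ≤ 1 + ∑ j, rankOn K (fun e => x e j) E)
    (E : Finset (α ⊕ β)) (hE : E.Nonempty) (hn : E.toLeft.card ≤ n)
    (hcard : E.toRight.card ≤ E.toLeft.card)
    (hsum : ∑ e ∈ E, c e • (fun A : κ → X => ∏ j, x e j (A j)) = 0) :
    ∃ a b, .inl a ∈ E ∧ .inr b ∈ E ∧
      c (.inl a) • (fun A : κ → X => ∏ j, x (.inl a) j (A j)) +
        c (.inr b) • (fun A : κ → X => ∏ j, x (.inr b) j (A j)) = 0 := by
  induction E using Finset.strongInduction with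
  | H E ih =>
  have hcardE := E.card_toLeft_add_card_toRight
  by_cases hconn : ConnectedOn K (fun e (A : κ → X) => ∏ j, x e j (A j)) E
  · have hq : E.toLeft.card < 2 := by
      by_contra! hq
      obtain ⟨a, ha⟩ := hE
      have h1 := hconn.sum_rankOn_le x ⟨a, ha⟩ Finset.univ hne
      have h2 := rankOn_lt_card_of_sum_eq_zero ha (hc a) hsum
      have h3 := hrank E hq hn
      rw [Finset.card_univ] at h1
      omega
    have hpos := hE.card_pos
    obtain ⟨a, ha⟩ := Finset.card_eq_one.1 (show E.toLeft.card = 1 by omega)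
    rw [← E.toLeft_disjSum_toRight, Finset.sum_disjSum, ha, Finset.sum_singleton] at hsum
    have haE : Sum.inl a ∈ E := by simp [← Finset.mem_toLeft, ha]
    obtain hr | hr : E.toRight.card = 0 ∨ E.toRight.card = 1 := by omega
    · exfalso
      rw [Finset.card_eq_zero.1 hr, Finset.sum_empty, add_zero] at hsum
      choose A hA using fun j => Function.ne_iff.1 (hne (.inl a) j)
      exact Finset.prod_ne_zero_iff.2 (fun j _ => hA j)
        (congrFun ((smul_eq_zero.1 hsum).resolve_left (hc _)) A)
    · obtain ⟨b, hb⟩ := Finset.card_eq_one.1 hr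
      rw [hb, Finset.sum_singleton] at hsum
      exact ⟨a, b, haE, by simp [← Finset.mem_toRight, hb], hsum⟩
  · obtain ⟨S, hS, hS1, hS2, hd⟩ : ∃ S ⊆ E, S.Nonempty ∧ (E \ S).Nonempty ∧
        Disjoint (span K ((fun e (A : κ → X) => ∏ j, x e j (A j)) '' S))
          (span K ((fun e (A : κ → X) => ∏ j, x e j (A j)) '' (E \ S : Finset (α ⊕ β)))) := by
      simpa only [ConnectedOn, not_forall, not_not, exists_prop] using hconn
    have hmem : ∀ H : Finset (α ⊕ β), ∑ e ∈ H, c e • (fun A : κ → X => ∏ j, x e j (A j)) ∈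
        span K ((fun e (A : κ → X) => ∏ j, x e j (A j)) '' H) :=
      fun H => sum_mem fun e he => smul_mem _ _ (subset_span ⟨e, he, rfl⟩)
    rw [← Finset.sum_sdiff hS] at hsum
    have hS0 := Submodule.disjoint_def.1 hd _ (hmem S)
      (by rw [eq_neg_of_add_eq_zero_right hsum]; exact neg_mem (hmem _))
    rw [hS0, add_zero] at hsum
    have hl := Finset.toLeft_subset_toLeft hS
    have hr := Finset.toRight_subset_toRight hS
    have hl' := Finset.card_sdiff_add_card_eq_card hl
    have hr' := Finset.card_sdiff_add_card_eq_card hr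
    rw [← Finset.toLeft_sdiff] at hl'
    rw [← Finset.toRight_sdiff] at hr'
    obtain hle | hle : S.toRight.card ≤ S.toLeft.card ∨
      (E \ S).toRight.card ≤ (E \ S).toLeft.card := by omega
    · obtain ⟨a, b, ha, hb, hab⟩ := ih S (Finset.ssubset_iff_subset_ne.2
        ⟨hS, fun h => by simp [h] at hS2⟩) hS1 (by omega) hle hS0
      exact ⟨a, b, hS ha, hS hb, hab⟩
    · obtain ⟨a, b, ha, hb, hab⟩ := ih (E \ S) (Finset.sdiff_ssubset hS hS1) hS2 (by omega) hle hsum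
      exact ⟨a, b, Finset.sdiff_subset ha, Finset.sdiff_subset hb, hab⟩

theorem forall_exists_pair_relation {x : α ⊕ β → κ → X → K} {c : α ⊕ β → K} (hc : ∀ e, c e ≠ 0)
    (hne : ∀ e j, x e j ≠ 0) {n : ℕ}
    (hrank : ∀ E : Finset (α ⊕ β), 2 ≤ E.toLeft.card → E.toLeft.card ≤ n →
      2 * E.toLeft.card + Fintype.card κ ≤ 1 + ∑ j, rankOn K (fun e => x e j) E)
    (E : Finset (α ⊕ β)) (hn : E.toLeft.card ≤ n) (hcard : E.toRight.card = E.toLeft.card)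
    (hsum : ∑ e ∈ E, c e • (fun A : κ → X => ∏ j, x e j (A j)) = 0)
    {a : α} (ha : .inl a ∈ E) :
    ∃ b, c (.inl a) • (fun A : κ → X => ∏ j, x (.inl a) j (A j)) +
        c (.inr b) • (fun A : κ → X => ∏ j, x (.inr b) j (A j)) = 0 := by
  induction E using Finset.strongInduction with
  | H E ih =>
  obtain ⟨a', b, ha', hb, hab⟩ := exists_pair_relation hc hne hrank E ⟨_, ha⟩ hn hcard.le hsum
  by_cases haa : a = a'
  · exact ⟨b, haa ▸ hab⟩
  · have hb' : Sum.inr b ∈ E.erase (.inl a') := Finset.mem_erase.2 ⟨Sum.inr_ne_inl, hb⟩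
    have hleft : ((E.erase (.inl a')).erase (.inr b)).toLeft = E.toLeft.erase a' := by
      ext; simp
    have hright : ((E.erase (.inl a')).erase (.inr b)).toRight = E.toRight.erase b := by
      ext; simp
    have h1 := Finset.card_erase_add_one (Finset.mem_toLeft.2 ha')
    have h2 := Finset.card_erase_add_one (Finset.mem_toRight.2 hb)
    refine ih _ ((Finset.erase_subset _ _).trans_ssubset (Finset.erase_ssubset ha'))
      (by rw [hleft]; omega) (by rw [hleft, hright]; omega) ?_ (by simp [haa, ha])
    rwa [← Finset.add_sum_erase _ _ ha', ← Finset.add_sum_erase _ _ hb', ← add_assoc, hab,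
      zero_add] at hsum

end Matching

section Mixtures

/-- The values of a measure on all measurable sets. -/
noncomputable def measureValues (ν : ProbabilityMeasure ℝ) :
    {s : Set ℝ // MeasurableSet s} → ℝ :=
  fun s => (ν : Measure ℝ).real s

theorem measureValues_univ (ν : ProbabilityMeasure ℝ) :
    measureValues ν ⟨Set.univ, MeasurableSet.univ⟩ = 1 := by
  simp [measureValues]

theorem measureValues_ne_zero (ν : ProbabilityMeasure ℝ) : measureValues ν ≠ 0 := fun h => by
  simpa [measureValues_univ] using congrFun h ⟨Set.univ, MeasurableSet.univ⟩

theorem measureValues_injective : Function.Injective measureValues := by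
  intro ν ν' h
  have hν : (ν : Measure ℝ) = (ν' : Measure ℝ) := Measure.ext fun s hs =>
    (measureReal_eq_measureReal_iff (measure_ne_top _ s) (measure_ne_top _ s)).1
      (congrFun h ⟨s, hs⟩)
  exact Subtype.ext hν

theorem linearIndepOn_measureValues {m : ℕ} {ν : Fin m → ProbabilityMeasure ℝ} {I : Finset (Fin m)}
    (h : LinearIndependent ℝ (fun i : I => ((ν i : Measure ℝ)).toSignedMeasure)) :
    LinearIndepOn ℝ (fun k => measureValues (ν k)) (I : Set (Fin m)) := by
  let L : SignedMeasure ℝ →ₗ[ℝ] ({s : Set ℝ // MeasurableSet s} → ℝ) :=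
    { toFun := fun v s => v s
      map_add' := fun v w => by ext s; simp
      map_smul' := fun a v => by ext s; simp }
  have hL : LinearMap.ker L = ⊥ := by
    rw [LinearMap.ker_eq_bot']
    intro v hv
    ext s hs
    exact congrFun hv ⟨s, hs⟩
  have hfun : (fun i : I => measureValues (ν i)) =
      L ∘ fun i : I => ((ν i : Measure ℝ)).toSignedMeasure := by
    ext i s
    simp [L, measureValues, Measure.toSignedMeasure_apply_measurable s.2]
  change LinearIndependent ℝ (fun i : I => measureValues (ν i))
  exact hfun ▸ h.map' L hL

theorem indOf_mem {m : ℕ} (ν : Fin m → ProbabilityMeasure ℝ) :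
    indOf ν ≤ m ∧ EllIndep ν (indOf ν) := by
  refine Nat.sSup_mem (s := {ℓ : ℕ | ℓ ≤ m ∧ EllIndep ν ℓ}) ⟨0, Nat.zero_le _, ?_⟩
    ⟨m, fun ℓ hℓ => hℓ.1⟩
  intro I hI
  rw [Finset.card_eq_zero] at hI
  subst hI
  exact linearIndependent_empty_type

theorem one_le_indOf {m : ℕ} (hm : 1 ≤ m) (ν : Fin m → ProbabilityMeasure ℝ) : 1 ≤ indOf ν := by
  refine le_csSup (s := {ℓ : ℕ | ℓ ≤ m ∧ EllIndep ν ℓ}) ⟨m, fun ℓ hℓ => hℓ.1⟩ ⟨hm, ?_⟩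
  intro I hI
  obtain ⟨a, rfl⟩ := Finset.card_eq_one.1 hI
  refine LinearIndependent.of_subsingleton ⟨a, Finset.mem_singleton_self a⟩ fun h => ?_
  have := congrArg (fun v : SignedMeasure ℝ => v Set.univ) h
  simp at this

theorem exists_linearIndepOn_measureValues {m : ℕ} (ν : Fin m → ProbabilityMeasure ℝ)
    (Q : Finset (Fin m)) : ∃ I ⊆ Q, I.card = min (indOf ν) Q.card ∧
      LinearIndepOn ℝ (fun k => measureValues (ν k)) (I : Set (Fin m)) := by
  obtain ⟨hle, hind⟩ := indOf_mem ν
  obtain ⟨I, hIQ, hI⟩ := Finset.exists_subset_card_eq (min_le_right (indOf ν) Q.card)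
  obtain ⟨J, hIJ, -, hJ⟩ := Finset.exists_subsuperset_card_eq (Finset.subset_univ I)
    (n := indOf ν) (by omega) (by simpa using hle)
  exact ⟨I, hIQ, hI, (linearIndepOn_measureValues (hind J hJ)).mono (Finset.coe_subset.2 hIJ)⟩

theorem min_indOf_le_rankOn {m : ℕ} {β : Type*} (ν : Fin m ⊕ β → ProbabilityMeasure ℝ)
    (E : Finset (Fin m ⊕ β)) :
    min (indOf fun k => ν (.inl k)) E.toLeft.card ≤ rankOn ℝ (fun e => measureValues (ν e)) E := by
  obtain ⟨I, hIE, hI, hind⟩ := exists_linearIndepOn_measureValues (fun k => ν (.inl k)) E.toLeft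
  rw [← hI, ← rankOn_eq_card hind]
  refine Submodule.finrank_mono (Submodule.span_mono ?_)
  rintro _ ⟨k, hk, rfl⟩
  exact ⟨.inl k, Finset.mem_toLeft.1 (hIE hk), rfl⟩

theorem injective_of_two_le_indOf {m : ℕ} {ν : Fin m → ProbabilityMeasure ℝ} (h : 2 ≤ indOf ν) :
    Function.Injective ν := by
  intro a b hab
  by_contra hne
  obtain ⟨I, hI, hcard, hind⟩ := exists_linearIndepOn_measureValues ν {a, b}
  rw [Finset.card_pair hne, min_eq_right h] at hcard
  obtain rfl := Finset.eq_of_subset_of_card_le hI (by rw [hcard, Finset.card_pair hne])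
  exact hne (hind.injOn (by simp) (by simp) (congrArg measureValues hab))

theorem min_tauOf_add_card_le {m d : ℕ} (hm : 1 ≤ m) (μ : Fin m → Fin d → ProbabilityMeasure ℝ)
    (S : Finset (Fin d)) {q : ℕ} (hq : 1 ≤ q) :
    min (tauOf μ S) q + S.card ≤ 1 + ∑ j ∈ S, min (indOf fun k => μ k j) q := by
  have h1 : ∀ j, 1 ≤ min (indOf fun k => μ k j) q := fun j => le_min (one_le_indOf hm _) hq
  have hcard : ∀ T : Finset (Fin d), T.card ≤ ∑ j ∈ T, min (indOf fun k => μ k j) q := fun T => by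
    simpa using Finset.card_nsmul_le_sum T _ 1 fun j _ => h1 j
  by_cases h : ∃ i ∈ S, q ≤ indOf fun k => μ k i
  · obtain ⟨i, hi, hqi⟩ := h
    have h2 := hcard (S.erase i)
    have h3 := Finset.card_erase_add_one hi
    rw [← Finset.add_sum_erase _ _ hi, min_eq_right hqi]
    omega
  · push Not at h
    have h2 := hcard S
    rw [Finset.sum_congr rfl fun j hj => min_eq_left (h j hj).le] at h2 ⊢
    simp only [tauOf]
    omega

theorem two_mul_add_card_le_sum_min_indOf {m d : ℕ} (μ : Fin m → Fin d → ProbabilityMeasure ℝ)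
    {S₁ S₂ S₃ : Finset (Fin d)}
    (h12 : Disjoint S₁ S₂) (h13 : Disjoint S₁ S₃) (h23 : Disjoint S₂ S₃)
    (hcover : S₁ ∪ S₂ ∪ S₃ = Finset.univ)
    (hτ : 2 * m + 2 ≤ tauOf μ S₁ + tauOf μ S₂ + tauOf μ S₃) {q : ℕ} (hq : 2 ≤ q) (hqm : q ≤ m) :
    2 * q + d ≤ 1 + ∑ j, min (indOf fun k => μ k j) q := by
  have hle : ∀ S, tauOf μ S ≤ m := fun S => min_le_left _ _
  have e1 := min_tauOf_add_card_le (by omega) μ S₁ (show 1 ≤ q by omega)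
  have e2 := min_tauOf_add_card_le (by omega) μ S₂ (show 1 ≤ q by omega)
  have e3 := min_tauOf_add_card_le (by omega) μ S₃ (show 1 ≤ q by omega)
  have l1 := hle S₁
  have l2 := hle S₂
  have l3 := hle S₃
  have h123 : Disjoint (S₁ ∪ S₂) S₃ := Finset.disjoint_union_left.2 ⟨h13, h23⟩
  have hd : d = S₁.card + S₂.card + S₃.card := by
    rw [← Finset.card_union_of_disjoint h12, ← Finset.card_union_of_disjoint h123, hcover]
    simp
  rw [← hcover, Finset.sum_union h123, Finset.sum_union h12]
  omega

theorem mixtureOfProducts_real_pi {m d : ℕ} {π : Fin m → ℝ} (hπ : ∀ k, 0 < π k)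
    (μ : Fin m → Fin d → ProbabilityMeasure ℝ) (A : Fin d → {s : Set ℝ // MeasurableSet s}) :
    (mixtureOfProducts π μ).real (Set.univ.pi fun j => (A j : Set ℝ)) =
      ∑ k, π k * ∏ j, measureValues (μ k j) (A j) := by
  rw [mixtureOfProducts, measureReal_def, Measure.finsetSum_apply, ENNReal.toReal_sum]
  · refine Finset.sum_congr rfl fun k _ => ?_
    rw [Measure.smul_apply, Measure.pi_pi, smul_eq_mul, ENNReal.toReal_mul, ENNReal.toReal_prod,
      ENNReal.toReal_ofReal (hπ k).le]
    rfl
  · intro k _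
    rw [Measure.smul_apply, Measure.pi_pi, smul_eq_mul]
    exact ENNReal.mul_ne_top ENNReal.ofReal_ne_top (ENNReal.prod_ne_top fun j _ => by finiteness)

/-- A weighted product of probability measures determines its weight and its factors. -/
theorem eq_of_mul_prod_measureValues_eq {d : ℕ} {p p' : ℝ} (hp : 0 < p)
    {ν ν' : Fin d → ProbabilityMeasure ℝ}
    (h : ∀ A : Fin d → {s : Set ℝ // MeasurableSet s},
      p * ∏ j, measureValues (ν j) (A j) = p' * ∏ j, measureValues (ν' j) (A j)) :
    p = p' ∧ ν = ν' := by
  let Ω : {s : Set ℝ // MeasurableSet s} := ⟨Set.univ, MeasurableSet.univ⟩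
  have hΩ : ∀ ρ, measureValues ρ Ω = 1 := measureValues_univ
  have hpp : p = p' := by simpa [hΩ] using h fun _ => Ω
  subst hpp
  refine ⟨rfl, funext fun i => measureValues_injective (funext fun s => ?_)⟩
  have hA : ∀ ρ : Fin d → ProbabilityMeasure ℝ, ∏ j, measureValues (ρ j)
      (Function.update (fun _ => Ω) i s j) =
        measureValues (ρ i) s := by
    intro ρ
    rw [Finset.prod_eq_single_of_mem i (Finset.mem_univ i), Function.update_self]
    intro j _ hj
    rw [Function.update_of_ne hj, hΩ]
  have := h (Function.update (fun _ => Ω) i s)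
  rw [hA, hA] at this
  exact mul_left_cancel₀ hp.ne' this

end Mixtures

/-- **General identifiability theorem.** If `[d]` can be partitioned into `S₁, S₂, S₃` with
`τ_μ(S₁) + τ_μ(S₂) + τ_μ(S₃) ≥ 2m + 2`, then the mixture is identifiable. -/
theorem identifiability_of_tau_partition {m d : ℕ} (hm : 2 ≤ m) (hd : 1 ≤ d)
    (π : Fin m → ℝ) (μ : Fin m → Fin d → ProbabilityMeasure ℝ)
    (hπ : ∀ k, 0 < π k) (hπsum : ∑ k, π k = 1)
    (S₁ S₂ S₃ : Finset (Fin d))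
    (h12 : Disjoint S₁ S₂) (h13 : Disjoint S₁ S₃) (h23 : Disjoint S₂ S₃)
    (hcover : S₁ ∪ S₂ ∪ S₃ = Finset.univ)
    (hτ : 2 * m + 2 ≤ tauOf μ S₁ + tauOf μ S₂ + tauOf μ S₃) :
    IsIdentifiable π μ := by
  intro π' μ' hπ' _ hmix
  let ν : Fin m ⊕ Fin m → Fin d → ProbabilityMeasure ℝ := Sum.elim μ μ'
  let c : Fin m ⊕ Fin m → ℝ := Sum.elim π fun k => - π' k
  have hc : ∀ e, c e ≠ 0 := by
    rintro (k | k)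
    · exact (hπ k).ne'
    · exact neg_ne_zero.2 (hπ' k).ne'
  have hrank : ∀ E : Finset (Fin m ⊕ Fin m), 2 ≤ E.toLeft.card → E.toLeft.card ≤ m →
      2 * E.toLeft.card + Fintype.card (Fin d) ≤
        1 + ∑ j, rankOn ℝ (fun e => measureValues (ν e j)) E := by
    intro E h2 hm
    have h := two_mul_add_card_le_sum_min_indOf μ h12 h13 h23 hcover hτ h2 hm
    rw [Fintype.card_fin]
    refine h.trans (Nat.add_le_add_left (Finset.sum_le_sum fun j _ =>
      min_indOf_le_rankOn (fun e => ν e j) E) 1)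
  have hleft : (Finset.univ : Finset (Fin m ⊕ Fin m)).toLeft = Finset.univ := by ext; simp
  have hright : (Finset.univ : Finset (Fin m ⊕ Fin m)).toRight = Finset.univ := by ext; simp
  have hsum : ∑ e, c e • (fun A : Fin d → {s : Set ℝ // MeasurableSet s} =>
      ∏ j, measureValues (ν e j) (A j)) = 0 := by
    ext A
    have h1 := mixtureOfProducts_real_pi hπ μ A
    have h2 := mixtureOfProducts_real_pi hπ' μ' A
    rw [hmix, h1] at h2
    simp [Fintype.sum_sum_type, c, ν, h2]
  have hmatch : ∀ k, ∃ k', π k = π' k' ∧ μ k = μ' k' := by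
    intro k
    obtain ⟨k', hk'⟩ := forall_exists_pair_relation hc (fun e j => measureValues_ne_zero (ν e j))
      hrank Finset.univ (by simp [hleft]) (by simp [hleft, hright]) hsum (Finset.mem_univ (Sum.inl k))
    refine ⟨k', eq_of_mul_prod_measureValues_eq (hπ k) fun A => ?_⟩
    have h := congrFun hk' A
    simp only [c, ν, Pi.add_apply, Pi.smul_apply, smul_eq_mul, Sum.elim_inl, Sum.elim_inr,
      Pi.zero_apply] at h
    linarith
  choose σ hσ using hmatch
  obtain ⟨j, hj⟩ : ∃ j, 2 ≤ indOf fun k => μ k j := by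
    by_contra! hcon
    have h := two_mul_add_card_le_sum_min_indOf μ h12 h13 h23 hcover hτ le_rfl hm
    have h2 : ∑ j, min (indOf fun k => μ k j) 2 ≤ ∑ _j : Fin d, 1 :=
      Finset.sum_le_sum fun j _ => by have := hcon j; omega
    simp at h2
    omega
  have hinj : Function.Injective σ := fun a b hab =>
    injective_of_two_le_indOf hj (congrFun ((hσ a).2.trans (hab ▸ (hσ b).2.symm)) j)
  refine ⟨Equiv.ofBijective σ (Finite.injective_iff_bijective.1 hinj), fun k => ?_⟩
  exact ⟨(hσ k).1, fun j => congrFun (hσ k).2 j⟩
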